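/- arXiv:2001.05690 — 4 statements merged into one kernel-verified Lean document; each statement's English description precedes it below -/
import Mathlib

section
/- Let f ∈ [0,1], let t ∈ [0,1] with t ≤ a for a threshold a ∈ (0,1), and let μ = f·λ + (1−f)·δ_t be the sensor measure. For two independent identical sensors, the probability that the conjunctive reading produces a false positive equals (μ ×ₘ μ) {(x, y) : x > a ∧ y > a} = f²·(1−a)². -/
open MeasureTheory

theorem sensor_measure_Ioi {f t a : ℝ} (hf : 0 ≤ f) (ha : 0 ≤ a) (hta : t ≤ a) :
    (ENNReal.ofReal f • (volume.restrict (Set.Icc (0:ℝ) 1))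
      + ENNReal.ofReal (1 - f) • Measure.dirac t) (Set.Ioi a)
      = ENNReal.ofReal (f * (1 - a)) := by
  have hset : Set.Ioi a ∩ Set.Icc (0:ℝ) 1 = Set.Ioc a 1 := by
    ext x
    simp only [Set.mem_inter_iff, Set.mem_Ioi, Set.mem_Icc, Set.mem_Ioc]
    exact ⟨fun h => ⟨h.1, h.2.2⟩, fun h => ⟨h.1, ha.trans h.1.le, h.2⟩⟩
  have hdirac : Measure.dirac t (Set.Ioi a) = 0 := by
    simp [Measure.dirac_apply' t measurableSet_Ioi, hta]
  rw [Measure.add_apply, Measure.smul_apply, Measure.smul_apply, hdirac,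
    Measure.restrict_apply measurableSet_Ioi, hset, Real.volume_Ioc, smul_zero, add_zero,
    smul_eq_mul, ENNReal.ofReal_mul hf]

theorem conjunctive_two_sensor_false_positive
    (f t a : ℝ) (hf : f ∈ Set.Icc (0:ℝ) 1) (ht : t ∈ Set.Icc (0:ℝ) 1)
    (ha : a ∈ Set.Ioo (0:ℝ) 1) (hta : t ≤ a)
    (μ : Measure ℝ)
    (hμ : μ = ENNReal.ofReal f • (volume.restrict (Set.Icc (0:ℝ) 1))
            + ENNReal.ofReal (1 - f) • Measure.dirac t) :
    (μ.prod μ) {p : ℝ × ℝ | a < p.1 ∧ a < p.2}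
      = ENNReal.ofReal (f ^ 2 * (1 - a) ^ 2) := by
  have hsf : SFinite μ := by rw [hμ]; infer_instance
  have hprod : {p : ℝ × ℝ | a < p.1 ∧ a < p.2} = Set.Ioi a ×ˢ Set.Ioi a := rfl
  have hIoi : μ (Set.Ioi a) = ENNReal.ofReal (f * (1 - a)) := by
    rw [hμ, sensor_measure_Ioi hf.1 ha.1.le hta]
  rw [hprod, Measure.prod_prod, hIoi,
    ← ENNReal.ofReal_mul (mul_nonneg hf.1 (sub_nonneg.2 ha.2.le))]
  congr 1
  ring
end

section
/- Let f ∈ [0,1], let t ∈ [0,1] with t ≤ a for a threshold a ∈ (0,1), and let μ = f·λ + (1−f)·δ_t be the sensor measure. For two independent identical sensors, the probability that the disjunctive reading produces a false positive equals (μ ×ₘ μ) {(x, y) : x > a ∨ y > a} = f·(1−a)·(2 − f·(1−a)), and this quantity equals f·(1−a)·(f·(1+a) + 2·(1−f)). -/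
open MeasureTheory

theorem prob_prod_or_eq_one_sub_sq {μ : Measure ℝ} [IsProbabilityMeasure μ] (a : ℝ) :
    (μ.prod μ) {p : ℝ × ℝ | a < p.1 ∨ a < p.2} = 1 - μ (Set.Iic a) * μ (Set.Iic a) := by
  have hset : {p : ℝ × ℝ | a < p.1 ∨ a < p.2} = (Set.Iic a ×ˢ Set.Iic a)ᶜ := by
    ext p
    simp only [Set.mem_ofPred_eq, Set.mem_compl_iff, Set.mem_prod, Set.mem_Iic, not_and_or, not_le]
  rw [hset, prob_compl_eq_one_sub (measurableSet_Iic.prod measurableSet_Iic), Measure.prod_prod]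

theorem disjunctive_two_sensor_false_positive
    (f t a : ℝ) (hf : f ∈ Set.Icc (0:ℝ) 1) (ht : t ∈ Set.Icc (0:ℝ) 1)
    (ha : a ∈ Set.Ioo (0:ℝ) 1) (hta : t ≤ a)
    (μ : Measure ℝ)
    (hμ : μ = ENNReal.ofReal f • (volume.restrict (Set.Icc (0:ℝ) 1))
            + ENNReal.ofReal (1 - f) • Measure.dirac t) :
    (μ.prod μ) {p : ℝ × ℝ | a < p.1 ∨ a < p.2}
      = ENNReal.ofReal (f * (1 - a) * (2 - f * (1 - a)))
    ∧ f * (1 - a) * (2 - f * (1 - a))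
      = f * (1 - a) * (f * (1 + a) + 2 * (1 - f)) := by
  obtain ⟨hf0, hf1⟩ := hf
  obtain ⟨ha0, ha1⟩ := ha
  refine ⟨?_, by ring⟩
  have hprob : IsProbabilityMeasure μ := ⟨by
    simp [hμ, ← ENNReal.ofReal_add hf0 (sub_nonneg.2 hf1)]⟩
  have hinter : Set.Iic a ∩ Set.Icc 0 1 = Set.Icc 0 a := by
    ext x
    simp only [Set.mem_inter_iff, Set.mem_Iic, Set.mem_Icc]
    exact ⟨fun h => ⟨h.2.1, h.1⟩, fun h => ⟨h.2, h.1, h.2.trans ha1.le⟩⟩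
  have hIic : μ (Set.Iic a) = ENNReal.ofReal (f * a + (1 - f)) := by
    rw [hμ, Measure.add_apply, Measure.smul_apply, Measure.smul_apply,
      Measure.restrict_apply measurableSet_Iic, hinter, Real.volume_Icc,
      Measure.dirac_apply_of_mem (Set.mem_Iic.2 hta), smul_eq_mul, smul_eq_mul, mul_one, sub_zero,
      ← ENNReal.ofReal_mul hf0, ← ENNReal.ofReal_add (by positivity) (sub_nonneg.2 hf1)]
  have hnonneg : 0 ≤ f * a + (1 - f) := add_nonneg (by positivity) (sub_nonneg.2 hf1)
  rw [prob_prod_or_eq_one_sub_sq, hIic, ← ENNReal.ofReal_mul hnonneg, ← ENNReal.ofReal_one,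
    ← ENNReal.ofReal_sub _ (by positivity)]
  congr 1
  ring
end

section
/- Let f ∈ [0,1], let t ∈ [0,1] with t > a for a threshold a ∈ (0,1), and let μ = f·λ + (1−f)·δ_t be the sensor measure. For two independent identical sensors, the probability that the disjunctive reading produces a false negative equals (μ ×ₘ μ) {(x, y) : x ≤ a ∧ y ≤ a} = f²·a². -/
open MeasureTheory

/-- The probability that a single sensor with true value above the threshold reads negative. -/
theorem sensor_measure_Iic {f t a : ℝ} (hf : 0 ≤ f) (ha : a ≤ 1) (hta : a < t) :
    (ENNReal.ofReal f • (volume.restrict (Set.Icc (0:ℝ) 1))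
      + ENNReal.ofReal (1 - f) • Measure.dirac t) (Set.Iic a) = ENNReal.ofReal (f * a) := by
  have hinter : Set.Iic a ∩ Set.Icc (0:ℝ) 1 = Set.Icc 0 a := by
    ext x
    simp only [Set.mem_inter_iff, Set.mem_Iic, Set.mem_Icc]
    grind
  simp [Measure.restrict_apply measurableSet_Iic, hinter, hta, ENNReal.ofReal_mul hf]

theorem disjunctive_two_sensor_false_negative
    (f t a : ℝ) (hf : f ∈ Set.Icc (0:ℝ) 1) (ht : t ∈ Set.Icc (0:ℝ) 1)
    (ha : a ∈ Set.Ioo (0:ℝ) 1) (hta : a < t)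
    (μ : Measure ℝ)
    (hμ : μ = ENNReal.ofReal f • (volume.restrict (Set.Icc (0:ℝ) 1))
            + ENNReal.ofReal (1 - f) • Measure.dirac t) :
    (μ.prod μ) {p : ℝ × ℝ | p.1 ≤ a ∧ p.2 ≤ a}
      = ENNReal.ofReal (f ^ 2 * a ^ 2) := by
  have hset : {p : ℝ × ℝ | p.1 ≤ a ∧ p.2 ≤ a} = Set.Iic a ×ˢ Set.Iic a := rfl
  have : SFinite μ := by rw [hμ]; infer_instance
  rw [hset, Measure.prod_prod, hμ, sensor_measure_Iic hf.1 ha.2.le hta,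
    ← ENNReal.ofReal_mul (mul_nonneg hf.1 ha.1.le)]
  ring_nf
end

section
/- Let f ∈ [0,1], let t ∈ [0,1], and let μ = f·λ + (1−f)·δ_t be the sensor measure. For three independent identical sensors, the probability that no two of the three readings are equal (i.e., all three readings are pairwise distinct) equals 3·(1−f)·f² + f³, and this quantity equals f²·(3 − 2·f). -/
open MeasureTheory

/-- The integral of a function that agrees with a constant off a set of zero measure, against a
mixture of a probability measure and a Dirac mass. -/
lemma lintegral_mixture_dirac_eq_of_ae_eq_const {α : Type*} [MeasurableSpace α]
    [MeasurableSingletonClass α] (ν : Measure α) [IsProbabilityMeasure ν] (a b c : ENNReal)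
    (t : α) (g : α → ENNReal) (hg : ∀ᵐ x ∂ν, g x = c) :
    ∫⁻ x, g x ∂(a • ν + b • Measure.dirac t) = a * c + b * g t := by
  rw [lintegral_add_measure, lintegral_smul_measure, lintegral_smul_measure, lintegral_dirac,
    lintegral_congr_ae hg]
  simp

/-- Three independent samples from a mixture of an atomless probability measure and a Dirac mass
are pairwise distinct exactly when at most one of them comes from the Dirac mass, up to a null
event. -/
lemma mixture_dirac_prod_pairwise_ne {α : Type*} [MeasurableSpace α] [MeasurableEq α]
    (ν : Measure α) [IsProbabilityMeasure ν] [NullSingletonClass ν]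
    (a b : ENNReal) (t : α) [SFinite (a • ν + b • Measure.dirac t)] :
    ((a • ν + b • Measure.dirac t).prod
      ((a • ν + b • Measure.dirac t).prod (a • ν + b • Measure.dirac t)))
        {p : α × α × α | p.1 ≠ p.2.1 ∧ p.1 ≠ p.2.2 ∧ p.2.1 ≠ p.2.2}
      = a * (a * (a + b) + b * a) + b * (a * a) := by
  classical
  have h_ne (x : α) : ∀ᵐ y ∂ν, y ≠ x := by simp [ae_iff]
  have h_meas : MeasurableSet
      {p : α × α × α | p.1 ≠ p.2.1 ∧ p.1 ≠ p.2.2 ∧ p.2.1 ≠ p.2.2} := by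
    refine MeasurableSet.inter ?_ (MeasurableSet.inter ?_ ?_)
    · exact (measurableSet_eq_fun (by fun_prop) (by fun_prop)).compl
    · exact (measurableSet_eq_fun (by fun_prop) (by fun_prop)).compl
    · exact (measurableSet_eq_fun (by fun_prop) (by fun_prop)).compl
  have h_third (x y : α) (hxy : x ≠ y) :
      (a • ν + b • Measure.dirac t) {z | x ≠ y ∧ x ≠ z ∧ y ≠ z}
        = a + b * if x ≠ t ∧ y ≠ t then 1 else 0 := by
    have h_one : ν {z | x ≠ y ∧ x ≠ z ∧ y ≠ z} = 1 := by
      rw [← measure_univ (μ := ν)]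
      refine measure_congr ?_
      filter_upwards [h_ne x, h_ne y] with z hx hy
      exact eq_true ⟨hxy, hx.symm, hy.symm⟩
    rw [Measure.add_apply, Measure.smul_apply, Measure.smul_apply, h_one, Measure.dirac_apply]
    simp [Set.indicator_apply, hxy]
  have h_second (x : α) :
      ((a • ν + b • Measure.dirac t).prod (a • ν + b • Measure.dirac t))
        (Prod.mk x ⁻¹' {p : α × α × α | p.1 ≠ p.2.1 ∧ p.1 ≠ p.2.2 ∧ p.2.1 ≠ p.2.2})
        = if x = t then a * a else a * (a + b) + b * a := by
    rw [Measure.prod_apply (measurable_prodMk_left h_meas)]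
    change ∫⁻ y, (a • ν + b • Measure.dirac t) {z | x ≠ y ∧ x ≠ z ∧ y ≠ z} ∂_ = _
    rw [lintegral_mixture_dirac_eq_of_ae_eq_const ν a b (a + b * if x ≠ t then 1 else 0)]
    · by_cases hxt : x = t
      · simp [hxt]
      · rw [h_third x t hxt]
        simp [hxt]
    · filter_upwards [h_ne x, h_ne t] with y hx ht
      rw [h_third x y hx.symm]
      simp [ht]
  rw [Measure.prod_apply h_meas]
  simp_rw [h_second]
  rw [lintegral_mixture_dirac_eq_of_ae_eq_const ν a b (a * (a + b) + b * a)]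
  · simp
  · filter_upwards [h_ne t] with x hx
    simp [hx]

theorem three_sensor_all_distinct_probability
    (f t : ℝ) (hf : f ∈ Set.Icc (0:ℝ) 1) (ht : t ∈ Set.Icc (0:ℝ) 1)
    (μ : Measure ℝ)
    (hμ : μ = ENNReal.ofReal f • (volume.restrict (Set.Icc (0:ℝ) 1))
            + ENNReal.ofReal (1 - f) • Measure.dirac t) :
    (μ.prod (μ.prod μ))
        {p : ℝ × ℝ × ℝ | p.1 ≠ p.2.1 ∧ p.1 ≠ p.2.2 ∧ p.2.1 ≠ p.2.2}
      = ENNReal.ofReal (3 * (1 - f) * f ^ 2 + f ^ 3)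
    ∧ 3 * (1 - f) * f ^ 2 + f ^ 3 = f ^ 2 * (3 - 2 * f) := by
  refine ⟨?_, by ring⟩
  obtain ⟨hf₀, hf₁⟩ := hf
  have hf₂ : 0 ≤ 1 - f := sub_nonneg.mpr hf₁
  have : IsProbabilityMeasure (volume.restrict (Set.Icc (0:ℝ) 1)) := ⟨by simp⟩
  rw [hμ, mixture_dirac_prod_pairwise_ne]
  rw [← ENNReal.ofReal_add hf₀ hf₂, ← ENNReal.ofReal_mul hf₀, ← ENNReal.ofReal_mul hf₂,
    ← ENNReal.ofReal_mul hf₀, ← ENNReal.ofReal_add (by positivity) (by positivity),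
    ← ENNReal.ofReal_mul hf₀, ← ENNReal.ofReal_mul hf₂,
    ← ENNReal.ofReal_add (by positivity) (by positivity)]
  congr 1
  ring
end
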